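/- arXiv:2308.07588 — 3 statements merged into one kernel-verified Lean document; each statement's English description precedes it below -/
import Mathlib

section
/- Let W ⊆ ℝ be an interval and let h : W → ℝ be twice differentiable and α-exp-concave, and suppose h(x) − h(y) ≤ m for all x, y ∈ W, where m > 0. Set γ = 4·max{m, 1/α}. Then for all x, y ∈ W: h((x+y)/2) ≤ (1/2)·h(x) + (1/2)·h(y) − (h(x) − h(y))²/(4γ). -/
/-- **Lemma 1 (negative term lemma).**
Let `W ⊆ ℝ` be an interval and `h : W → ℝ` twice differentiable and `α`-exp-concave
(`α * h'(w)^2 ≤ h''(w)` on `W`), with `h x - h y ≤ m` for all `x, y ∈ W`, `m > 0`.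
With `γ = 4 * max m (1/α)`, for all `x, y ∈ W`:
`h((x+y)/2) ≤ h(x)/2 + h(y)/2 - (h x - h y)^2 / (4γ)`. -/
theorem negative_term_lemma
    (W : Set ℝ) (hW : Convex ℝ W)
    (h : ℝ → ℝ) (α m γ : ℝ) (hα : 0 < α) (hm : 0 < m)
    (hdiff : ∀ w ∈ W, DifferentiableAt ℝ h w)
    (hdiff2 : ∀ w ∈ W, DifferentiableAt ℝ (deriv h) w)
    (hexp : ∀ w ∈ W, α * (deriv h w) ^ 2 ≤ deriv (deriv h) w)
    (hbound : ∀ x ∈ W, ∀ y ∈ W, h x - h y ≤ m)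
    (hγ : γ = 4 * max m (1 / α)) :
    ∀ x ∈ W, ∀ y ∈ W,
      h ((x + y) / 2) ≤ (1 / 2) * h x + (1 / 2) * h y - (h x - h y) ^ 2 / (4 * γ) := by
  intro x hx y hy
  set M := max m (1 / α) with hM
  have hMm : m ≤ M := le_max_left _ _
  have hMa : 1 / α ≤ M := le_max_right _ _
  have hMpos : 0 < M := lt_of_lt_of_le hm hMm
  have haM : 1 ≤ α * M := by
    have := mul_le_mul_of_nonneg_left hMa hα.le
    rwa [mul_one_div_cancel hα.ne'] at this
  obtain ⟨β, hβ⟩ : ∃ β, β = 1 / M := ⟨_, rfl⟩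
  have hβpos : 0 < β := by rw [hβ]; positivity
  have hβM : β * M = 1 := by rw [hβ]; field_simp
  have hβα : β ≤ α := by nlinarith
  have hβm : β * m ≤ 1 := by nlinarith
  have hconc : ConcaveOn ℝ W (fun w => Real.exp (-β * h w)) := by
    refine concaveOn_of_hasDerivWithinAt2_nonpos hW
      (f' := fun w => Real.exp (-β * h w) * (-β * deriv h w))
      (f'' := fun w => Real.exp (-β * h w) * (-β * deriv h w) * (-β * deriv h w)
        + Real.exp (-β * h w) * (-β * deriv (deriv h) w)) ?_ ?_ ?_ ?_
    · intro w hw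
      exact (((hdiff w hw).continuousAt.const_mul (-β)).rexp).continuousWithinAt
    · intro w hw
      exact (((hdiff w (interior_subset hw)).hasDerivAt.const_mul (-β)).exp).hasDerivWithinAt
    · intro w hw
      exact ((((hdiff w (interior_subset hw)).hasDerivAt.const_mul (-β)).exp).mul
        ((hdiff2 w (interior_subset hw)).hasDerivAt.const_mul (-β))).hasDerivWithinAt
    · intro w hw
      have h1 := hexp w (interior_subset hw)
      have h2 : β * (deriv h w) ^ 2 ≤ deriv (deriv h) w :=
        le_trans (mul_le_mul_of_nonneg_right hβα (sq_nonneg _)) h1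
      have h3 : 0 ≤ Real.exp (-β * h w) * (β * (deriv (deriv h) w - β * (deriv h w) ^ 2)) :=
        mul_nonneg (Real.exp_pos _).le (mul_nonneg hβpos.le (by linarith))
      linarith
  have hmid := hconc.2 hx hy (by norm_num : (0:ℝ) ≤ 1 / 2) (by norm_num : (0:ℝ) ≤ 1 / 2)
    (by norm_num)
  have hxy : (1 / 2 : ℝ) • x + (1 / 2 : ℝ) • y = (x + y) / 2 := by
    simp only [smul_eq_mul]; ring
  rw [hxy] at hmid
  simp only [smul_eq_mul] at hmid
  obtain ⟨u, hu⟩ : ∃ u, u = β * (h x - h y) / 2 := ⟨_, rfl⟩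
  have hb1 := hbound x hx y hy
  have hb2 := hbound y hy x hx
  have hu1 : u ≤ 1 / 2 := by rw [hu]; nlinarith
  have hu2 : -(1 / 2) ≤ u := by rw [hu]; nlinarith
  have husq : u ^ 2 ≤ 1 / 4 := by nlinarith
  have hc1 : Real.exp (u ^ 2 / 4) ≤ 1 + u ^ 2 / 2 := by
    have h1 := Real.add_one_le_exp (-(u ^ 2 / 4))
    have h2 : Real.exp (u ^ 2 / 4) * Real.exp (-(u ^ 2 / 4)) = 1 := by
      rw [← Real.exp_add]; simp
    have h3 := Real.exp_pos (u ^ 2 / 4)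
    have h4 : Real.exp (u ^ 2 / 4) * (1 - u ^ 2 / 4) ≤ 1 := by nlinarith
    have h5 : 0 < 1 - u ^ 2 / 4 := by linarith
    have h6 : 1 ≤ (1 + u ^ 2 / 2) * (1 - u ^ 2 / 4) := by nlinarith [sq_nonneg u]
    exact le_of_mul_le_mul_right (h4.trans h6) h5
  have hc2 : 1 + u ^ 2 / 2 ≤ Real.cosh u := by
    have h1 : Real.cosh u = Real.cosh (u / 2) ^ 2 + Real.sinh (u / 2) ^ 2 := by
      rw [← Real.cosh_two_mul]; congr 1; ring
    have h2 := Real.cosh_sq (u / 2)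
    have h3 : (u / 2) ^ 2 ≤ Real.sinh (u / 2) ^ 2 := by
      rcases le_total 0 (u / 2) with h0 | h0
      · have := Real.self_le_sinh_iff.mpr h0
        nlinarith
      · have := Real.sinh_le_self_iff.mpr h0
        nlinarith
    linarith
  rw [Real.cosh_eq] at hc2
  have hc3 : Real.exp (u ^ 2 / 4) ≤ (Real.exp u + Real.exp (-u)) / 2 := hc1.trans hc2
  have key : Real.exp (-β * ((h x + h y) / 2) + u ^ 2 / 4)
      ≤ Real.exp (-β * h ((x + y) / 2)) := by
    refine le_trans ?_ hmid
    have e1 : -β * h x = -β * ((h x + h y) / 2) + -u := by rw [hu]; ring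
    have e2 : -β * h y = -β * ((h x + h y) / 2) + u := by rw [hu]; ring
    rw [e1, e2, Real.exp_add, Real.exp_add, Real.exp_add]
    have := mul_le_mul_of_nonneg_left hc3 (Real.exp_pos (-β * ((h x + h y) / 2))).le
    linarith
  have key2 := Real.exp_le_exp.mp key
  have e3 : (h x - h y) ^ 2 / (4 * γ) = β * (h x - h y) ^ 2 / 16 := by
    rw [hγ, hβ]; field_simp; norm_num
  rw [e3]
  rw [hu] at key2
  refine le_of_mul_le_mul_left ?_ hβpos
  linarith
end

section
/- Let W ⊆ ℝ be an interval and let h : W → ℝ be twice differentiable and α-exp-concave, and suppose h(x) − h(y) ≤ m for all x, y ∈ W, where m > 0. Set γ = 4·max{m, 1/α}. Then for all x, y ∈ W: h(x) − h(y) ≤ 2·h(x) − 2·h((x+y)/2) − (h(x) − h(y))²/(2γ). -/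
open Real in
theorem aux_cosh (t : ℝ) (ht : t ^ 2 ≤ 1) :
    exp (t ^ 2 / 16) ≤ (exp (t / 2) + exp (-(t / 2))) / 2 := by
  have key : ∀ s : ℝ, 0 ≤ s → 1 + s ^ 2 / 2 ≤ (exp s + exp (-s)) / 2 := by
    intro s _
    have h1 : cosh s = 1 + 2 * sinh (s / 2) ^ 2 := by
      have h2 := cosh_two_mul (s / 2)
      have h3 := cosh_sq (s / 2)
      rw [show 2 * (s / 2) = s by ring] at h2
      linarith
    have h4 : s / 2 ≤ sinh (s / 2) := self_le_sinh_iff.2 (by linarith)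
    rw [← cosh_eq, h1]
    nlinarith
  have key2 : 1 + (t / 2) ^ 2 / 2 ≤ (exp (t / 2) + exp (-(t / 2))) / 2 := by
    rcases le_total 0 t with h | h
    · exact key _ (by linarith)
    · have := key (-(t / 2)) (by linarith)
      rw [neg_neg] at this
      linarith [neg_sq (t / 2)]
  refine le_trans ?_ key2
  have h5 := add_one_le_exp (-(t ^ 2 / 16))
  have h6 : exp (t ^ 2 / 16) * exp (-(t ^ 2 / 16)) = 1 := by
    rw [← exp_add]; simp
  have h7 := exp_pos (t ^ 2 / 16)
  have h8 : exp (t ^ 2 / 16) * (1 - t ^ 2 / 16) ≤ 1 := by nlinarith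
  have h9 : 1 ≤ (1 + (t / 2) ^ 2 / 2) * (1 - t ^ 2 / 16) := by nlinarith [sq_nonneg t]
  exact le_of_mul_le_mul_right (h8.trans h9) (by linarith)

theorem aux_concave (W : Set ℝ) (hW : Convex ℝ W) (h : ℝ → ℝ) (β : ℝ) (hβ : 0 < β)
    (hdiff : ∀ w ∈ W, DifferentiableAt ℝ h w)
    (hdiff2 : ∀ w ∈ W, DifferentiableAt ℝ (deriv h) w)
    (hexp : ∀ w ∈ W, β * (deriv h w) ^ 2 ≤ deriv (deriv h) w) :
    ConcaveOn ℝ W (fun w => Real.exp (-β * h w)) := by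
  have d1 : ∀ w ∈ W, HasDerivAt (fun w => Real.exp (-β * h w))
      (Real.exp (-β * h w) * (-β * deriv h w)) w := fun w hw =>
    ((hdiff w hw).hasDerivAt.const_mul (-β)).exp
  have d2 : ∀ w ∈ W, HasDerivAt (fun w => Real.exp (-β * h w) * (-β * deriv h w))
      (Real.exp (-β * h w) * (-β * deriv h w) * (-β * deriv h w)
        + Real.exp (-β * h w) * (-β * deriv (deriv h) w)) w := fun w hw =>
    (d1 w hw).mul ((hdiff2 w hw).hasDerivAt.const_mul (-β))
  refine concaveOn_of_hasDerivWithinAt2_nonpos hW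
    (fun w hw => (d1 w hw).continuousAt.continuousWithinAt)
    (fun w hw => (d1 w (interior_subset hw)).hasDerivWithinAt)
    (fun w hw => (d2 w (interior_subset hw)).hasDerivWithinAt) ?_
  intro w hw
  have h1 := hexp w (interior_subset hw)
  have h2 := mul_nonneg (mul_pos (Real.exp_pos (-β * h w)) hβ).le (sub_nonneg.2 h1)
  nlinarith

/-- **Lemma 1 (negative term lemma).**
Let `W ⊆ ℝ` be an interval and `h : W → ℝ` twice differentiable and `α`-exp-concave
(`α * h'(w)^2 ≤ h''(w)` on `W`), with `h x - h y ≤ m` for all `x, y ∈ W`, `m > 0`.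
With `γ = 4 * max m (1/α)`, for all `x, y ∈ W`:
`h((x+y)/2) ≤ h(x)/2 + h(y)/2 - (h x - h y)^2 / (4γ)`. -/
theorem negative_term_rearranged
    (W : Set ℝ) (hW : Convex ℝ W)
    (h : ℝ → ℝ) (α m γ : ℝ) (hα : 0 < α) (hm : 0 < m)
    (hdiff : ∀ w ∈ W, DifferentiableAt ℝ h w)
    (hdiff2 : ∀ w ∈ W, DifferentiableAt ℝ (deriv h) w)
    (hexp : ∀ w ∈ W, α * (deriv h w) ^ 2 ≤ deriv (deriv h) w)
    (hbound : ∀ x ∈ W, ∀ y ∈ W, h x - h y ≤ m)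
    (hγ : γ = 4 * max m (1 / α)) :
    ∀ x ∈ W, ∀ y ∈ W,
      h x - h y ≤ 2 * h x - 2 * h ((x + y) / 2) - (h x - h y) ^ 2 / (2 * γ) := by
  intro x hx y hy
  set M := max m (1 / α) with hM
  have hMm : m ≤ M := le_max_left _ _
  have hMα : 1 / α ≤ M := le_max_right _ _
  have hM0 : 0 < M := hm.trans_le hMm
  have hβα : 1 / M ≤ α := by
    rw [div_le_iff₀ hM0]
    rw [div_le_iff₀ hα] at hMα
    linarith
  have hconc := aux_concave W hW h (1 / M) (by positivity) hdiff hdiff2 (fun w hw =>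
    (mul_le_mul_of_nonneg_right hβα (sq_nonneg _)).trans (hexp w hw))
  have hc := hconc.2 hx hy (by norm_num : (0 : ℝ) ≤ 1 / 2) (by norm_num : (0 : ℝ) ≤ 1 / 2)
    (by norm_num)
  simp only [smul_eq_mul] at hc
  rw [show 1 / 2 * x + 1 / 2 * y = (x + y) / 2 by ring] at hc
  have ht : ((h x - h y) / M) ^ 2 ≤ 1 := by
    rw [sq_le_one_iff_abs_le_one, abs_div, abs_of_pos hM0, div_le_one hM0, abs_le]
    constructor <;> linarith [hbound x hx y hy, hbound y hy x hx]
  have hcosh := aux_cosh _ ht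
  have hA := Real.exp_pos (-(1 / M) * ((h x + h y) / 2))
  have e1 : Real.exp (-(1 / M) * h x) = Real.exp (-(1 / M) * ((h x + h y) / 2))
      * Real.exp (-((h x - h y) / M / 2)) := by
    rw [← Real.exp_add]; congr 1; ring
  have e2 : Real.exp (-(1 / M) * h y) = Real.exp (-(1 / M) * ((h x + h y) / 2))
      * Real.exp ((h x - h y) / M / 2) := by
    rw [← Real.exp_add]; congr 1; ring
  have hfin : Real.exp (-(1 / M) * ((h x + h y) / 2) + ((h x - h y) / M) ^ 2 / 16)
      ≤ Real.exp (-(1 / M) * h ((x + y) / 2)) := by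
    rw [Real.exp_add]
    refine (mul_le_mul_of_nonneg_left hcosh hA.le).trans ?_
    rw [e1, e2] at hc
    linarith
  rw [Real.exp_le_exp] at hfin
  have hf := mul_le_mul_of_nonneg_left hfin hM0.le
  have e3 : M * (-(1 / M) * ((h x + h y) / 2) + ((h x - h y) / M) ^ 2 / 16)
      = -((h x + h y) / 2) + (h x - h y) ^ 2 / (2 * γ) / 2 := by
    rw [hγ]; field_simp; ring
  have e4 : M * (-(1 / M) * h ((x + y) / 2)) = - h ((x + y) / 2) := by
    field_simp
  rw [e3, e4] at hf
  linarith
end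

section
/- Let p̂, p* ∈ Δ^d be probability vectors with p*(i) > 0 for all i, and let H(p) = −∑_{i=1}^d p(i)·log(p(i)) denote the Shannon entropy. Then 2·H((1/2)·p̂ + (1/2)·p*) − H(p̂) ≤ H(p*) + KL(p̂‖p*). -/
open Real Finset

/-- **Entropy inequality used for discrete distribution estimation.**
For probability vectors `p̂, p⋆ ∈ Δ^d` with `p⋆(i) > 0` for all `i`, with
`H(p) = -∑ p i * log (p i)` and `KL(p̂‖p⋆) = ∑ p̂ i * log (p̂ i / p⋆ i)`:
`2 H((p̂ + p⋆)/2) - H(p̂) ≤ H(p⋆) + KL(p̂‖p⋆)`. -/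
theorem entropy_midpoint_bound (d : ℕ) (phat pstar : Fin d → ℝ)
    (hphat_nonneg : ∀ i, 0 ≤ phat i) (hphat_sum : ∑ i, phat i = 1)
    (hpstar_pos : ∀ i, 0 < pstar i) (hpstar_sum : ∑ i, pstar i = 1)
    (H : (Fin d → ℝ) → ℝ) (hH : ∀ p : Fin d → ℝ, H p = -∑ i, p i * Real.log (p i)) :
    2 * H (fun i => (1 / 2) * phat i + (1 / 2) * pstar i) - H phat
      ≤ H pstar + ∑ i, phat i * Real.log (phat i / pstar i) := by
  have key : ∀ i, -(2 * (((1 / 2) * phat i + (1 / 2) * pstar i) *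
      Real.log ((1 / 2) * phat i + (1 / 2) * pstar i))) + phat i * Real.log (phat i)
      ≤ -(pstar i * Real.log (pstar i)) + phat i * Real.log (phat i / pstar i)
        + (pstar i - phat i) := by
    intro i
    have hp := hphat_nonneg i
    have hq := hpstar_pos i
    have hm : 0 < (1 / 2) * phat i + (1 / 2) * pstar i := by linarith
    have h1 : phat i * Real.log (phat i / pstar i)
        = phat i * Real.log (phat i) - phat i * Real.log (pstar i) := by
      rcases hp.eq_or_lt with h | h
      · simp [← h]
      · rw [Real.log_div h.ne' hq.ne']; ring
    rw [h1]
    generalize hmm : (1 / 2) * phat i + (1 / 2) * pstar i = m at *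
    have h2 := Real.log_le_sub_one_of_pos (div_pos hq hm)
    rw [Real.log_div hq.ne' hm.ne'] at h2
    have h3 := mul_le_mul_of_nonneg_left h2 hm.le
    have h4 : m * (pstar i / m - 1) = pstar i - m := by field_simp
    rw [h4] at h3
    have h5 : phat i = 2 * m - pstar i := by linarith
    rw [h5]
    nlinarith
  have hs := Finset.sum_le_sum (fun i (_ : i ∈ Finset.univ) => key i)
  simp only [Finset.sum_add_distrib, Finset.sum_neg_distrib, Finset.sum_sub_distrib,
    ← Finset.mul_sum, hphat_sum, hpstar_sum] at hs
  rw [hH, hH, hH]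
  linarith
end
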